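/- Convergence of K-worker naively quantized gradient descent (NQ-GD). Let K ≥ 1 and let f_1, …, f_K : E → ℝ be differentiable, with f_k being L_k-smooth for reals L_k > 0. Let f = (1/K)·Σ_{k=1}^K f_k be L-smooth and μ-strongly convex (0 < μ ≤ L), and let x* minimize every f_k simultaneously (interpolation setting); assume ‖x̂_0 − x*‖ ≤ D with D > 0. For each k let q_k : E → E and ε_k > 0 satisfy ‖q_k(u) − u‖ ≤ ε_k whenever ‖u‖ ≤ 1. Set η_GD = 2/(L+μ), σ_GD = (L−μ)/(L+μ), σ := σ_GD + (η_GD/K)·Σ_{k=1}^K ε_k·L_k, and dynamic ranges r_{t,k} := σ^t·L_k·D. Suppose the iterates satisfy x̂_{t+1} = x̂_t − (η_GD/K)·Σ_{k=1}^K r_{t,k}·q_k(∇f_k(x̂_t)/r_{t,k}). Then for every t ≥ 0, ‖x̂_t − x*‖ ≤ σ^t·D. -/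

import Mathlib

section

variable {E : Type*} [NormedAddCommGroup E] [InnerProductSpace ℝ E]

/-- Cocoercivity of a gradient (Baillon–Haddad), from two-sided Bregman bounds. -/
lemma norm_sub_sq_le_mul_inner_of_bregman_bounds {h : E → ℝ} {H : E → E} {l : ℝ} (hl : 0 ≤ l)
    (hlow : ∀ x y, h x + inner ℝ (H x) (y - x) ≤ h y)
    (hup : ∀ x y, h y ≤ h x + inner ℝ (H x) (y - x) + l / 2 * ‖y - x‖ ^ 2) (x z : E) :
    ‖H x - H z‖ ^ 2 ≤ l * inner ℝ (H x - H z) (x - z) := by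
  have key : ∀ (s : ℝ) (x z : E),
      (s - l * s ^ 2 / 2) * ‖H x - H z‖ ^ 2 ≤ h x - h z - inner ℝ (H z) (x - z) := by
    intro s x z
    have h1 := hlow z (x - s • (H x - H z))
    have h2 := hup x (x - s • (H x - H z))
    rw [sub_sub_cancel_left, norm_neg, norm_smul, mul_pow, Real.norm_eq_abs, sq_abs,
      inner_neg_right, inner_smul_right] at h2
    rw [sub_right_comm, inner_sub_right, inner_smul_right] at h1
    have h3 : ‖H x - H z‖ ^ 2 = inner ℝ (H x) (H x - H z) - inner ℝ (H z) (H x - H z) := by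
      rw [← inner_sub_left, real_inner_self_eq_norm_sq]
    have h4 : s * ‖H x - H z‖ ^ 2 =
      s * inner ℝ (H x) (H x - H z) - s * inner ℝ (H z) (H x - H z) := by rw [h3]; ring
    linarith
  have key2 : ∀ s : ℝ,
      (2 * s - l * s ^ 2) * ‖H x - H z‖ ^ 2 ≤ inner ℝ (H x - H z) (x - z) := by
    intro s
    have h1 := key s x z
    have h2 := key s z x
    rw [norm_sub_rev (H z), ← neg_sub x z, inner_neg_right] at h2
    rw [inner_sub_left]
    linarith
  rcases hl.eq_or_lt with rfl | hl
  · by_contra! hne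
    rw [zero_mul] at hne
    have := key2 ((inner ℝ (H x - H z) (x - z) + 1) / (2 * ‖H x - H z‖ ^ 2))
    rw [zero_mul, sub_zero, mul_assoc, mul_comm, mul_assoc, mul_comm _ (2 : ℝ),
      div_mul_cancel₀ _ (by positivity)] at this
    linarith
  · have := mul_le_mul_of_nonneg_left (key2 l⁻¹) hl.le
    field_simp at this
    linarith

/-- Rescaled quantization has error at most the dynamic range times the unit-ball error. -/
lemma norm_smul_quantize_sub_le {q : E → E} {ε r : ℝ} (hq : ∀ v, ‖v‖ ≤ 1 → ‖q v - v‖ ≤ ε)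
    (hr : 0 < r) {g : E} (hg : ‖g‖ ≤ r) : ‖r • q (r⁻¹ • g) - g‖ ≤ r * ε := by
  have h1 : ‖r⁻¹ • g‖ ≤ 1 := by
    rw [norm_smul, norm_inv, Real.norm_of_nonneg hr.le, inv_mul_le_one₀ hr]
    exact hg
  have h2 : r • q (r⁻¹ • g) - g = r • (q (r⁻¹ • g) - r⁻¹ • g) := by
    rw [smul_sub, smul_inv_smul₀ hr.ne']
  rw [h2, norm_smul, Real.norm_of_nonneg hr.le]
  exact mul_le_mul_of_nonneg_left (hq _ h1) hr.le

variable [CompleteSpace E]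

/-- The derivative of a function with a gradient along a line. -/
lemma HasGradientAt.hasDerivAt_comp_line {f : E → ℝ} {g x v : E} {t : ℝ}
    (h : HasGradientAt f g (x + t • v)) :
    HasDerivAt (fun s : ℝ => f (x + s • v)) (inner ℝ g v) t := by
  have hl : HasDerivAt (fun s : ℝ => x + s • v) v t := by
    simpa using ((hasDerivAt_id t).smul_const v).const_add x
  exact h.hasFDerivAt.comp_hasDerivAt t hl

/-- The quadratic upper bound for a function with Lipschitz gradient. -/
lemma le_add_inner_add_sq_of_lipschitz_gradient {f : E → ℝ} {G : E → E} {L : ℝ}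
    (hf : ∀ x, HasGradientAt f (G x) x) (hL : ∀ x y, ‖G x - G y‖ ≤ L * ‖x - y‖) (x y : E) :
    f y ≤ f x + inner ℝ (G x) (y - x) + L / 2 * ‖y - x‖ ^ 2 := by
  set v := y - x with hv
  let φ : ℝ → ℝ := fun t => f (x + t • v) - t * inner ℝ (G x) v - L / 2 * ‖v‖ ^ 2 * t ^ 2
  have hφ : ∀ t, HasDerivAt φ
      (inner ℝ (G (x + t • v)) v - inner ℝ (G x) v - L * ‖v‖ ^ 2 * t) t := by
    intro t
    have h1 := (hf (x + t • v)).hasDerivAt_comp_line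
    have h2 := (hasDerivAt_id t).mul_const (inner ℝ (G x) v)
    have h3 := ((hasDerivAt_id t).pow 2).const_mul (L / 2 * ‖v‖ ^ 2)
    refine ((h1.sub h2).sub h3).congr_deriv ?_
    simp only [id_eq]
    ring
  have hanti : AntitoneOn φ (Set.Icc 0 1) := by
    refine antitoneOn_of_deriv_nonpos (convex_Icc 0 1)
      (fun t _ => (hφ t).continuousAt.continuousWithinAt)
      (fun t _ => (hφ t).differentiableAt.differentiableWithinAt) fun t ht => ?_
    rw [interior_Icc] at ht
    rw [(hφ t).deriv, ← inner_sub_left]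
    have h1 := real_inner_le_norm (G (x + t • v) - G x) v
    have h2 := hL (x + t • v) x
    rw [add_sub_cancel_left, norm_smul, Real.norm_of_nonneg ht.1.le] at h2
    nlinarith [mul_le_mul_of_nonneg_right h2 (norm_nonneg v)]
  have h01 := hanti (Set.left_mem_Icc.2 zero_le_one) (Set.right_mem_Icc.2 zero_le_one) zero_le_one
  simp only [φ, hv, one_smul, zero_smul, add_zero, add_sub_cancel] at h01
  linarith

/-- The first-order lower bound for a convex function with a gradient. -/
lemma ConvexOn.add_inner_le_of_hasGradientAt {f : E → ℝ} {g x : E}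
    (hc : ConvexOn ℝ Set.univ f) (hf : HasGradientAt f g x) (y : E) :
    f x + inner ℝ g (y - x) ≤ f y := by
  have hd : HasDerivAt (fun s : ℝ => f (x + s • (y - x))) (inner ℝ g (y - x)) 0 :=
    HasGradientAt.hasDerivAt_comp_line (by simpa using hf)
  have hcl : ConvexOn ℝ Set.univ (fun s : ℝ => f (x + s • (y - x))) := by
    have := hc.comp_affineMap (AffineMap.lineMap x y)
    refine (by simpa using this : ConvexOn ℝ Set.univ _).congr fun s _ => ?_
    simp [AffineMap.lineMap_apply, add_comm]
  have := hcl.le_slope_of_hasDerivAt (Set.mem_univ 0) (Set.mem_univ 1) zero_lt_one hd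
  simp [slope_def_field] at this
  linarith

/-- A gradient step of length `2 / (L + μ)` contracts distances by `(L - μ) / (L + μ)`. -/
lemma norm_sub_gradient_step_le {f : E → ℝ} {G : E → E} {L μ : ℝ} (hμ : 0 < μ) (hμL : μ ≤ L)
    (hf : ∀ x, HasGradientAt f (G x) x) (hL : ∀ x y, ‖G x - G y‖ ≤ L * ‖x - y‖)
    (hc : ConvexOn ℝ Set.univ (fun x => f x - μ / 2 * ‖x‖ ^ 2)) (x z : E) :
    ‖(x - z) - (2 / (L + μ)) • (G x - G z)‖ ≤ (L - μ) / (L + μ) * ‖x - z‖ := by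
  have hS : 0 < L + μ := by linarith
  have hquad : ∀ x y : E, ‖y‖ ^ 2 = ‖x‖ ^ 2 + 2 * inner ℝ x (y - x) + ‖y - x‖ ^ 2 := by
    intro x y
    rw [← norm_add_sq_real, add_sub_cancel]
  have hgrad : ∀ x, HasGradientAt (fun x => f x - μ / 2 * ‖x‖ ^ 2) (G x - μ • x) x := by
    intro x
    rw [hasGradientAt_iff_hasFDerivAt]
    have h1 := (hf x).hasFDerivAt
    have h2 := ((hasStrictFDerivAt_norm_sq x).hasFDerivAt).const_mul (μ / 2)
    refine (h1.sub h2).congr_fderiv ?_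
    ext v
    simp
    ring
  have hco := norm_sub_sq_le_mul_inner_of_bregman_bounds (H := fun x => G x - μ • x)
    (sub_nonneg.2 hμL) (fun x y => hc.add_inner_le_of_hasGradientAt (hgrad x) y)
    (fun x y => by
      have h1 := le_add_inner_add_sq_of_lipschitz_gradient hf hL x y
      have h2 := hquad x y
      simp only [inner_sub_left, real_inner_smul_left]
      rw [h2]
      linarith) x z
  have he : G x - μ • x - (G z - μ • z) = (G x - G z) - μ • (x - z) := by module
  simp only [he] at hco
  rw [norm_sub_sq_real, real_inner_smul_right, inner_sub_left _ (μ • (x - z)),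
    real_inner_smul_left, real_inner_self_eq_norm_sq, norm_smul, mul_pow, Real.norm_of_nonneg hμ.le] at hco
  refine le_of_pow_le_pow_left₀ two_ne_zero
    (mul_nonneg (div_nonneg (sub_nonneg.2 hμL) hS.le) (norm_nonneg _)) ?_
  rw [norm_sub_sq_real, real_inner_smul_right, norm_smul, mul_pow, mul_pow,
    Real.norm_of_nonneg (by positivity), real_inner_comm]
  rw [← sub_nonneg]
  have : ((L - μ) / (L + μ)) ^ 2 * ‖x - z‖ ^ 2 - (‖x - z‖ ^ 2
      - 2 * (2 / (L + μ) * inner ℝ (G x - G z) (x - z)) + (2 / (L + μ)) ^ 2 * ‖G x - G z‖ ^ 2)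
      = 4 / (L + μ) ^ 2 * ((L + μ) * inner ℝ (G x - G z) (x - z)
        - L * μ * ‖x - z‖ ^ 2 - ‖G x - G z‖ ^ 2) := by
    field_simp; ring
  rw [this]
  refine mul_nonneg (by positivity) ?_
  linarith

/-- The gradient vanishes at a global minimizer. -/
lemma gradient_eq_zero_of_forall_le {f : E → ℝ} {x : E} (h : ∀ y, f x ≤ f y) :
    gradient f x = 0 := by
  have : IsLocalMin f x := Filter.Eventually.of_forall h
  rw [gradient, this.fderiv_eq_zero, map_zero]

end

/-- Convergence of K-worker naively quantized gradient descent (NQ-GD). -/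
theorem nqgd_convergence (n : ℕ) (hn : 1 ≤ n) (K : ℕ) (hK : 1 ≤ K)
    (L μ D : ℝ) (hμ : 0 < μ) (hμL : μ ≤ L) (hD : 0 < D)
    (ηGD σGD : ℝ) (hηGD : ηGD = 2 / (L + μ)) (hσGD : σGD = (L - μ) / (L + μ))
    (fk : Fin K → EuclideanSpace ℝ (Fin n) → ℝ)
    (hfk : ∀ k, Differentiable ℝ (fk k))
    (Lk : Fin K → ℝ) (hLk : ∀ k, 0 < Lk k)
    (hsmoothk : ∀ k, ∀ x y : EuclideanSpace ℝ (Fin n),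
      ‖gradient (fk k) x - gradient (fk k) y‖ ≤ Lk k * ‖x - y‖)
    (f : EuclideanSpace ℝ (Fin n) → ℝ)
    (hfdef : f = fun x => (1 / (K : ℝ)) * ∑ k : Fin K, fk k x)
    (hsmooth : ∀ x y : EuclideanSpace ℝ (Fin n),
      ‖gradient f x - gradient f y‖ ≤ L * ‖x - y‖)
    (hconv : ConvexOn ℝ Set.univ (fun x : EuclideanSpace ℝ (Fin n) => f x - μ / 2 * ‖x‖ ^ 2))
    (xs : EuclideanSpace ℝ (Fin n))
    (hinterp : ∀ k, ∀ x, fk k xs ≤ fk k x)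
    (qk : Fin K → EuclideanSpace ℝ (Fin n) → EuclideanSpace ℝ (Fin n))
    (εk : Fin K → ℝ) (hεk : ∀ k, 0 < εk k)
    (hqk : ∀ k, ∀ v : EuclideanSpace ℝ (Fin n), ‖v‖ ≤ 1 → ‖qk k v - v‖ ≤ εk k)
    (σ : ℝ) (hσ : σ = σGD + (ηGD / (K : ℝ)) * ∑ k : Fin K, εk k * Lk k)
    (r : ℕ → Fin K → ℝ) (hr : ∀ t k, r t k = σ ^ t * Lk k * D)
    (xh : ℕ → EuclideanSpace ℝ (Fin n))
    (hinit : ‖xh 0 - xs‖ ≤ D)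
    (hxh : ∀ t : ℕ, xh (t + 1) = xh t - (ηGD / (K : ℝ)) •
      ∑ k : Fin K, r t k • qk k ((r t k)⁻¹ • gradient (fk k) (xh t))) :
    ∀ t : ℕ, ‖xh t - xs‖ ≤ σ ^ t * D := by
  have hK0 : (0 : ℝ) < K := by exact_mod_cast hK
  have hη : 0 < ηGD / K := by
    rw [hηGD]
    exact div_pos (div_pos two_pos (by linarith)) hK0
  have hσGD0 : 0 ≤ σGD := by
    rw [hσGD]
    exact div_nonneg (by linarith) (by linarith)
  have hσpos : 0 < σ := by
    have : Nonempty (Fin K) := ⟨⟨0, hK⟩⟩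
    have h1 : 0 < ∑ k : Fin K, εk k * Lk k :=
      Finset.sum_pos (fun k _ => mul_pos (hεk k) (hLk k)) Finset.univ_nonempty
    rw [hσ]
    exact add_pos_of_nonneg_of_pos hσGD0 (mul_pos hη h1)
  have hGf : ∀ x, HasGradientAt f ((1 / (K : ℝ)) • ∑ k, gradient (fk k) x) x := by
    intro x
    rw [hasGradientAt_iff_hasFDerivAt, hfdef]
    refine ((HasFDerivAt.fun_sum fun k (_ : k ∈ Finset.univ) =>
      (hfk k x).hasGradientAt.hasFDerivAt).const_mul (1 / (K : ℝ))).congr_fderiv ?_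
    simp
  have hz : ∀ k, gradient (fk k) xs = 0 := fun k => gradient_eq_zero_of_forall_le (hinterp k)
  intro t
  induction t with
  | zero => simpa using hinit
  | succ t ih =>
    have hq : ∀ k, ‖r t k • qk k ((r t k)⁻¹ • gradient (fk k) (xh t)) - gradient (fk k) (xh t)‖
        ≤ r t k * εk k := by
      intro k
      have hLp := hLk k
      refine norm_smul_quantize_sub_le (hqk k) (by rw [hr]; positivity) ?_
      have h1 := hsmoothk k (xh t) xs
      rw [hz, sub_zero] at h1
      rw [hr]
      nlinarith [mul_le_mul_of_nonneg_left ih hLp.le]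
    have hstep := norm_sub_gradient_step_le hμ hμL hGf
      (fun x y => by simpa only [(hGf _).gradient] using hsmooth x y) hconv (xh t) xs
    simp only [hz, Finset.sum_const_zero, smul_zero, sub_zero] at hstep
    rw [← hηGD, ← hσGD, smul_smul, mul_one_div] at hstep
    have hsplit : xh (t + 1) - xs =
        (xh t - xs - (ηGD / (K : ℝ)) • ∑ k, gradient (fk k) (xh t)) -
        (ηGD / (K : ℝ)) • ∑ k, (r t k • qk k ((r t k)⁻¹ • gradient (fk k) (xh t))
          - gradient (fk k) (xh t)) := by
      rw [hxh, Finset.sum_sub_distrib]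
      module
    calc ‖xh (t + 1) - xs‖
        ≤ σGD * ‖xh t - xs‖ + ηGD / K * ∑ k, r t k * εk k := by
          rw [hsplit]
          refine (norm_sub_le _ _).trans (add_le_add hstep ?_)
          rw [norm_smul, Real.norm_of_nonneg hη.le]
          exact mul_le_mul_of_nonneg_left (norm_sum_le_of_le _ fun k _ => hq k) hη.le
      _ ≤ σGD * (σ ^ t * D) + ηGD / K * ∑ k, r t k * εk k := by gcongr
      _ = σ ^ t * D * (σGD + ηGD / K * ∑ k, εk k * Lk k) := by
          have : ∑ k, r t k * εk k = σ ^ t * D * ∑ k, εk k * Lk k := by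
            rw [Finset.mul_sum]
            exact Finset.sum_congr rfl fun k _ => by rw [hr]; ring
          rw [this]
          ring
      _ = σ ^ (t + 1) * D := by
          rw [← hσ]
          ring
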